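/- Let C be a set and H_MKW = (OF^C, ⧢, Δ_MKW) the Munthe-Kaas–Wright Hopf algebra on ordered forests of planar rooted trees with vertices decorated by C. Define ⊤: OF^C ⊗ OF^C → OF^C by ω_1 ⊤ ω_2 = (1/|ω_2|) Σ_{v ∈ N(ω_2)} ω_1 ⊤_v ω_2, where ω_1 ⊤_v ω_2 grafts all roots of ω_1 onto the vertex v of ω_2 and shuffles the newly attached edges with the existing outgoing edges of v, and |ω_2| is the number of vertices of ω_2. Then ⊤ is a natural growth operator for H_MKW: Δ̂_MKW(x ⊤ y) = x ⊗ y + x^(1) ⊗ (x^(2) ⊤ y) for all x ∈ H_MKW and all primitive y. -/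

import Mathlib

/-!
STATEMENT 16: Let C be a set and H_MKW = (OF^C, ⧢, Δ_MKW) the Munthe-Kaas–Wright Hopf
algebra on ordered forests of planar rooted trees decorated by C.  Define
ω₁ ⊤ ω₂ = (1/|ω₂|) Σ_{v ∈ N(ω₂)} ω₁ ⊤_v ω₂, where ω₁ ⊤_v ω₂ grafts all roots of ω₁
onto the vertex v of ω₂ and shuffles the new edges with the existing outgoing edges of
v.  Then ⊤ is a natural growth operator for H_MKW:
Δ̂_MKW(x ⊤ y) = x ⊗ y + x⁽¹⁾ ⊗ (x⁽²⁾ ⊤ y) for all x and all primitive y.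

The MKW coproduct Δ_MKW is realised below by left-admissible cuts, defined recursively:
a left-admissible cut of a forest prunes a leftmost prefix of the trees (possibly at
inner vertices, where the pruned subtrees form a left-closed block) and the pruned
parts from different vertices are shuffled while the trunks are concatenated.
-/

open TensorProduct

/-- Planar rooted forests with vertices decorated by `C`:
`nil` is the empty forest and `cons a c r` is the forest whose first (leftmost) tree
has root decorated by `a` with (ordered) children forest `c`, followed by the
forest `r`. -/
inductive PForest (C : Type*) : Type _
  | nil : PForest C
  | cons : C → PForest C → PForest C → PForest C

namespace PForest

variable {C : Type*}

/-- Concatenation of ordered forests. -/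
def append : PForest C → PForest C → PForest C
  | .nil, g => g
  | .cons a c r, g => .cons a c (r.append g)

/-- Number of vertices of a forest. -/
def size : PForest C → ℕ
  | .nil => 0
  | .cons _ c r => 1 + c.size + r.size

/-- Number of trees in a forest. -/
def len : PForest C → ℕ
  | .nil => 0
  | .cons _ _ r => 1 + r.len

end PForest

section Shuffles

variable {C : Type*}

/-- All shuffles of the trees of two ordered forests (fuelled version). -/
def shufflesAux : ℕ → PForest C → PForest C → List (PForest C)
  | 0, x, y => [x.append y]
  | _ + 1, .nil, y => [y]
  | _ + 1, .cons a c r, .nil => [PForest.cons a c r]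
  | n + 1, .cons a c r, .cons b d s =>
      ((shufflesAux n r (.cons b d s)).map (PForest.cons a c ·)) ++
        ((shufflesAux n (.cons a c r) s).map (PForest.cons b d ·))

/-- All shuffles of the trees of two ordered forests. -/
def shuffles (x y : PForest C) : List (PForest C) :=
  shufflesAux (x.len + y.len) x y

end Shuffles

section LinearSpan

variable (K : Type*) [Field K] (C : Type*)

/-- The vector space `OF^C` of (formal linear combinations of) ordered forests,
with the forests as a basis. -/
def OForest : Type _ := PForest C →₀ K

noncomputable instance : AddCommGroup (OForest K C) :=
  inferInstanceAs (AddCommGroup (PForest C →₀ K))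

noncomputable instance : Module K (OForest K C) :=
  inferInstanceAs (Module K (PForest C →₀ K))

variable {K C}

/-- The basis vector of a forest. -/
noncomputable def fof (f : PForest C) : OForest K C :=
  (Finsupp.single f 1 : PForest C →₀ K)

variable (K) in
/-- Linear extension of a map defined on basis forests. -/
noncomputable def liftF {M : Type*} [AddCommGroup M] [Module K M]
    (h : PForest C → M) : OForest K C →ₗ[K] M :=
  (Finsupp.lsum K fun f => LinearMap.toSpanSingleton K M (h f) :
    (PForest C →₀ K) →ₗ[K] M)

variable (K) in
/-- Bilinear extension of a map defined on pairs of basis forests. -/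
noncomputable def liftF2 {M : Type*} [AddCommGroup M] [Module K M]
    (h : PForest C → PForest C → M) :
    OForest K C →ₗ[K] OForest K C →ₗ[K] M :=
  liftF K fun f => liftF K (h f)

/-- The shuffle product `⧢` on `OF^C`. -/
noncomputable def shPr : OForest K C →ₗ[K] OForest K C →ₗ[K] OForest K C :=
  liftF2 K fun f g => ((shuffles f g).map fof).sum

/-- The concatenation product `·` on `OF^C`. -/
noncomputable def conPr : OForest K C →ₗ[K] OForest K C →ₗ[K] OForest K C :=
  liftF2 K fun f g => fof (f.append g)

/-- `B₊^a`: grafting a forest onto a new root decorated by `a`. -/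
noncomputable def BplusF (a : C) : OForest K C →ₗ[K] OForest K C :=
  liftF K fun f => fof (PForest.cons a f .nil)

/-- Componentwise (shuffle, concatenation) product on `OF ⊗ OF`:
`(P ⊗ T) (P' ⊗ T') ↦ (P ⧢ P') ⊗ (T · T')`. -/
noncomputable def cutMul :
    (OForest K C ⊗[K] OForest K C) ⊗[K] (OForest K C ⊗[K] OForest K C) →ₗ[K]
      OForest K C ⊗[K] OForest K C :=
  (TensorProduct.map (TensorProduct.lift shPr) (TensorProduct.lift conPr)) ∘ₗ
    (TensorProduct.tensorTensorTensorComm K _ _ _ _).toLinearMap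

end LinearSpan

section Cuts

variable {K : Type*} [Field K] {C : Type*}

mutual
  /-- The sum `Σ_c P^c ⊗ T^c` over the left-admissible cuts of a forest that do not
  remove any complete leftmost prefix of trees (the "inner" cuts): cuts of the trees
  of the forest, pruned parts shuffled and trunks concatenated. -/
  noncomputable def innerCuts : PForest C → OForest K C ⊗[K] OForest K C
    | .nil => fof .nil ⊗ₜ[K] fof .nil
    | .cons a c r =>
        cutMul
          (((LinearMap.lTensor (OForest K C) (BplusF a)) (prefCuts .nil c)) ⊗ₜ[K]
            innerCuts r)
  /-- `prefCuts pre f`: the sum `Σ_c P^c ⊗ T^c` over all left-admissible cuts of the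
  forest `pre · f` in which the whole prefix `pre` is pruned; the pruned prefix block
  is shuffled with the inner prunings. -/
  noncomputable def prefCuts : PForest C → PForest C → OForest K C ⊗[K] OForest K C
    | pre, .nil => fof pre ⊗ₜ[K] fof .nil
    | pre, .cons a c r =>
        (LinearMap.rTensor (OForest K C) (shPr (fof pre)))
          (cutMul
            (((LinearMap.lTensor (OForest K C) (BplusF a)) (prefCuts .nil c)) ⊗ₜ[K]
              innerCuts r)) +
        prefCuts (pre.append (.cons a c .nil)) r
end

/-- The Munthe-Kaas–Wright coproduct on `OF^C`, given by left-admissible cuts: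
`Δ_MKW(ω) = Σ_c P^c(ω) ⊗ T^c(ω)`. -/
noncomputable def deltaMKW :
    OForest K C →ₗ[K] OForest K C ⊗[K] OForest K C :=
  liftF (M := OForest K C ⊗[K] OForest K C) K fun f => prefCuts .nil f

/-- The reduced MKW coproduct `Δ̂_MKW(x) = Δ_MKW(x) − x ⊗ 1 − 1 ⊗ x`. -/
noncomputable def redMKW :
    OForest K C →ₗ[K] OForest K C ⊗[K] OForest K C :=
  deltaMKW (K := K) (C := C) -
    (TensorProduct.mk K (OForest K C) (OForest K C)).flip
      (fof (K := K) (C := C) PForest.nil) -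
    TensorProduct.mk K (OForest K C) (OForest K C) (fof (K := K) (C := C) PForest.nil)

end Cuts
section NaturalGrowthMKW

variable {K : Type*} [Field K] {C : Type*}

/-- Graft all the roots of the forest `w` onto one vertex of the target forest, summed
over all vertices of the target and over all shuffles of the newly attached trees with
the existing subtrees of that vertex. -/
noncomputable def graftShuffleF (w : PForest C) : PForest C → OForest K C
  | .nil => 0
  | .cons a c r =>
      ((shuffles w c).map (fun s => fof (PForest.cons a s r))).sum +
      (liftF K fun f => fof (PForest.cons a f r)) (graftShuffleF w c) +
      (liftF K fun f => fof (PForest.cons a c f)) (graftShuffleF w r)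

/-- The natural growth operator `⊤` of the MKW Hopf algebra:
`ω₁ ⊤ ω₂ = (1/|ω₂|) Σ_{v ∈ N(ω₂)} ω₁ ⊤_v ω₂`, where `ω₁ ⊤_v ω₂` grafts all roots of
`ω₁` onto the vertex `v` of `ω₂`, shuffling the newly attached edges with the existing
outgoing edges of `v`. -/
noncomputable def topMKW : OForest K C →ₗ[K] OForest K C →ₗ[K] OForest K C :=
  liftF2 K fun w f => ((f.size : K))⁻¹ • graftShuffleF w f

end NaturalGrowthMKW

section ForestCalculus

variable {K : Type*} [Field K] {C : Type*}

@[simp] theorem liftF_fof {M : Type*} [AddCommGroup M] [Module K M]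
    (h : PForest C → M) (f : PForest C) : liftF K h (fof f) = h f :=
  (Finsupp.lsum_single K (fun f => LinearMap.toSpanSingleton K M (h f)) f (1 : K)).trans
    (one_smul K (h f))

@[simp] theorem liftF2_fof_fof {M : Type*} [AddCommGroup M] [Module K M]
    (h : PForest C → PForest C → M) (f g : PForest C) :
    liftF2 K h (fof f) (fof g) = h f g := by
  simp [liftF2]

namespace OForest

theorem hom_ext {M : Type*} [AddCommGroup M] [Module K M] {φ ψ : OForest K C →ₗ[K] M}
    (h : ∀ f, φ (fof f) = ψ (fof f)) : φ = ψ :=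
  Finsupp.lhom_ext' (M := K) fun f => LinearMap.ext_ring (h f)

@[elab_as_elim]
theorem induction_on {p : OForest K C → Prop} (x : OForest K C)
    (fof : ∀ f, p (fof f)) (add : ∀ x y, p x → p y → p (x + y))
    (smul : ∀ (k : K) x, p x → p (k • x)) : p x := by
  have h0 : p 0 := by simpa using smul 0 _ (fof .nil)
  refine Finsupp.induction_linear (M := K) (motive := p) x h0 add fun f k => ?_
  have := smul k _ (fof f)
  have e : k • (_root_.fof f : OForest K C) = (Finsupp.single f k : PForest C →₀ K) := by
    change k • (Finsupp.single f 1 : PForest C →₀ K) = _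
    simp
  rwa [e] at this

end OForest

/-- The bilinear map `(c, r) ↦ B₊^a(c) · r`. -/
noncomputable def consPr (a : C) : OForest K C →ₗ[K] OForest K C →ₗ[K] OForest K C :=
  liftF2 K fun c r => fof (PForest.cons a c r)

theorem fof_cons (a : C) (c r : PForest C) :
    (fof (PForest.cons a c r) : OForest K C) = consPr a (fof c) (fof r) := by
  simp [consPr]

theorem shuffles_nil_left (y : PForest C) : shuffles .nil y = [y] := by
  unfold shuffles
  cases PForest.len .nil + y.len <;> simp [shufflesAux, PForest.append]

theorem shuffles_nil_right (x : PForest C) : shuffles x .nil = [x] := by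
  cases x with
  | nil => exact shuffles_nil_left _
  | cons a c r =>
    have h : (PForest.cons a c r).len + (PForest.nil : PForest C).len = r.len + 1 := by
      simp [PForest.len, add_comm]
    rw [shuffles, h, shufflesAux]

theorem shuffles_cons_cons (a b : C) (c r d s : PForest C) :
    shuffles (.cons a c r) (.cons b d s) =
      (shuffles r (.cons b d s)).map (PForest.cons a c ·) ++
        (shuffles (.cons a c r) s).map (PForest.cons b d ·) := by
  have h : (PForest.cons a c r).len + (PForest.cons b d s).len =
      (r.len + (PForest.cons b d s).len) + 1 := by
    simp only [PForest.len]; omega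
  have h' : (PForest.cons a c r).len + s.len = r.len + (PForest.cons b d s).len := by
    simp only [PForest.len]; omega
  rw [shuffles, h, shufflesAux, shuffles, shuffles, h']

theorem map_sum_fof {M : Type*} [AddCommGroup M] [Module K M] (φ : OForest K C →ₗ[K] M)
    (l : List (PForest C)) : φ ((l.map fof).sum) = (l.map fun f => φ (fof f)).sum := by
  rw [map_list_sum, List.map_map]; rfl

theorem shPr_nil_left (x : OForest K C) : shPr (fof .nil) x = x := by
  have : shPr (fof .nil) = (LinearMap.id : OForest K C →ₗ[K] OForest K C) :=
    OForest.hom_ext fun f => by simp [shPr, shuffles_nil_left]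
  rw [this, LinearMap.id_apply]

theorem shPr_nil_right (x : OForest K C) : shPr x (fof .nil) = x := by
  have : shPr.flip (fof .nil) = (LinearMap.id : OForest K C →ₗ[K] OForest K C) :=
    OForest.hom_ext fun f => by simp [shPr, shuffles_nil_right]
  exact LinearMap.congr_fun this x

theorem shPr_consPr_consPr (a b : C) (c r d s : OForest K C) :
    shPr (consPr a c r) (consPr b d s) =
      consPr a c (shPr r (consPr b d s)) + consPr b d (shPr (consPr a c r) s) := by
  induction c using OForest.induction_on with
  | add x y hx hy => simp only [map_add, LinearMap.add_apply, hx, hy]; abel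
  | smul k x hx => simp only [map_smul, LinearMap.smul_apply, hx, smul_add]
  | fof c =>
  induction r using OForest.induction_on with
  | add x y hx hy => simp only [map_add, LinearMap.add_apply, hx, hy]; abel
  | smul k x hx => simp only [map_smul, LinearMap.smul_apply, hx, smul_add]
  | fof r =>
  induction d using OForest.induction_on with
  | add x y hx hy => simp only [map_add, LinearMap.add_apply, hx, hy]; abel
  | smul k x hx => simp only [map_smul, LinearMap.smul_apply, hx, smul_add]
  | fof d =>
  induction s using OForest.induction_on with
  | add x y hx hy => simp only [map_add, hx, hy]; abel
  | smul k x hx => simp only [map_smul, hx, smul_add]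
  | fof s =>
  simp only [← fof_cons]
  simp only [shPr, liftF2_fof_fof, shuffles_cons_cons, List.map_append, List.sum_append,
    map_sum_fof, List.map_map, ← fof_cons]
  rfl

theorem shPr_comm (x y : OForest K C) : shPr x y = shPr y x := by
  suffices h : shPr (K := K) (C := C) = shPr.flip from LinearMap.congr_fun₂ h x y
  refine OForest.hom_ext fun f => OForest.hom_ext fun g => ?_
  rw [LinearMap.flip_apply]
  induction f generalizing g with
  | nil => rw [shPr_nil_left, shPr_nil_right]
  | cons a c r _ ihr =>
    induction g with
    | nil => rw [shPr_nil_left, shPr_nil_right]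
    | cons b d s _ ihs =>
      have h := ihr (.cons b d s)
      simp only [fof_cons] at h ihs ⊢
      rw [shPr_consPr_consPr, shPr_consPr_consPr, h, ihs, add_comm]

theorem shPr_assoc (x y z : OForest K C) : shPr (shPr x y) z = shPr x (shPr y z) := by
  induction x using OForest.induction_on with
  | add x y hx hy => simp only [map_add, LinearMap.add_apply, hx, hy]
  | smul k x hx => simp only [map_smul, LinearMap.smul_apply, hx]
  | fof f =>
  induction y using OForest.induction_on with
  | add x y hx hy => simp only [map_add, LinearMap.add_apply, hx, hy]
  | smul k x hx => simp only [map_smul, LinearMap.smul_apply, hx]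
  | fof g =>
  induction z using OForest.induction_on with
  | add x y hx hy => simp only [map_add, hx, hy]
  | smul k x hx => simp only [map_smul, hx]
  | fof h =>
  induction f generalizing g h with
  | nil => rw [shPr_nil_left, shPr_nil_left]
  | cons a c r _ ihr =>
    induction g generalizing h with
    | nil => rw [shPr_nil_left, shPr_nil_right]
    | cons b d s _ ihs =>
      induction h with
      | nil => rw [shPr_nil_right, shPr_nil_right]
      | cons e k t _ iht =>
        have h₁ := ihr (.cons b d s) (.cons e k t)
        have h₂ := ihs (.cons e k t)
        simp only [fof_cons] at h₁ h₂ iht ⊢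
        simp only [shPr_consPr_consPr, map_add, LinearMap.add_apply] at h₁ h₂ iht ⊢
        rw [h₁, h₂, ← add_assoc, ← add_assoc, ← iht]
        simp only [map_add]
        abel

end ForestCalculus

section ShuffleAlgebra

variable {K : Type*} [Field K] {C : Type*}

/-- The shuffle algebra structure on `OF^C`. -/
@[reducible] noncomputable def OForest.shuffleCommRing : CommRing (OForest K C) where
  __ := (inferInstance : AddCommGroup (OForest K C))
  mul x y := shPr x y
  one := fof .nil
  left_distrib x y z := map_add (shPr x) y z
  right_distrib x y z := LinearMap.map_add₂ shPr x y z
  zero_mul x := LinearMap.map_zero₂ shPr x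
  mul_zero x := map_zero (shPr x)
  mul_assoc := shPr_assoc
  one_mul := shPr_nil_left
  mul_one := shPr_nil_right
  mul_comm := shPr_comm

attribute [local instance] OForest.shuffleCommRing

/-- The `K`-algebra structure of the shuffle algebra `OF^C`. -/
@[reducible] noncomputable def OForest.shuffleAlgebra : Algebra K (OForest K C) :=
  Algebra.ofModule (fun k x y => LinearMap.map_smul₂ shPr k x y)
    (fun k x y => map_smul (shPr x) k y)

attribute [local instance] OForest.shuffleAlgebra

theorem shPr_eq_mul (x y : OForest K C) : shPr x y = x * y := rfl

theorem fof_nil : (fof .nil : OForest K C) = 1 := rfl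

theorem consPr_mul_consPr (a b : C) (c r d s : OForest K C) :
    consPr a c r * consPr b d s =
      consPr a c (r * consPr b d s) + consPr b d (consPr a c r * s) :=
  shPr_consPr_consPr a b c r d s

/-- The bilinear map `(p ⊗ t, p' ⊗ t') ↦ (p ⧢ p') ⊗ (B₊^a(t) · t')`. -/
noncomputable def cutCons (a : C) :
    OForest K C ⊗[K] OForest K C →ₗ[K] OForest K C ⊗[K] OForest K C →ₗ[K]
      OForest K C ⊗[K] OForest K C :=
  TensorProduct.map₂ (LinearMap.mul K (OForest K C)) (consPr a)

theorem cutCons_tmul (a : C) (p t p' t' : OForest K C) :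
    cutCons a (p ⊗ₜ[K] t) (p' ⊗ₜ[K] t') = (p * p') ⊗ₜ[K] consPr a t t' := by
  simp [cutCons]

theorem conPr_BplusF (a : C) (t t' : OForest K C) :
    conPr (BplusF a t) t' = consPr a t t' := by
  suffices h : conPr ∘ₗ BplusF a = consPr (K := K) a from LinearMap.congr_fun₂ h t t'
  refine OForest.hom_ext fun f => OForest.hom_ext fun g => ?_
  simp [BplusF, conPr, consPr, PForest.append]

theorem cutMul_BplusF (a : C) (u v : OForest K C ⊗[K] OForest K C) :
    cutMul ((LinearMap.lTensor (OForest K C) (BplusF a) u) ⊗ₜ[K] v) = cutCons a u v := by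
  induction u using TensorProduct.induction_on with
  | zero => simp
  | add x y hx hy => simp only [map_add, TensorProduct.add_tmul, LinearMap.add_apply, hx, hy]
  | tmul p t =>
  induction v using TensorProduct.induction_on with
  | zero => simp
  | add x y hx hy => simp only [map_add, TensorProduct.tmul_add, hx, hy]
  | tmul p' t' =>
  rw [cutCons_tmul, ← conPr_BplusF]
  rfl

theorem cutCons_mul_cutCons (a b : C) (u v u' v' : OForest K C ⊗[K] OForest K C) :
    cutCons a u v * cutCons b u' v' =
      cutCons a u (v * cutCons b u' v') + cutCons b u' (cutCons a u v * v') := by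
  induction u using TensorProduct.induction_on with
  | zero => simp
  | add x y hx hy => simp only [map_add, LinearMap.add_apply, add_mul, hx, hy]; abel
  | tmul p t =>
  induction v using TensorProduct.induction_on with
  | zero => simp
  | add x y hx hy => simp only [map_add, add_mul, hx, hy]; abel
  | tmul q s =>
  induction u' using TensorProduct.induction_on with
  | zero => simp
  | add x y hx hy => simp only [map_add, LinearMap.add_apply, mul_add, hx, hy]; abel
  | tmul p' t' =>
  induction v' using TensorProduct.induction_on with
  | zero => simp
  | add x y hx hy => simp only [map_add, mul_add, hx, hy]; abel
  | tmul q' s' =>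
  simp only [cutCons_tmul, Algebra.TensorProduct.tmul_mul_tmul, consPr_mul_consPr,
    TensorProduct.tmul_add]
  congr 2 <;> ring

/-- Linear extension of `innerCuts`. -/
noncomputable def innerL : OForest K C →ₗ[K] OForest K C ⊗[K] OForest K C :=
  liftF K innerCuts

theorem innerL_one : innerL (1 : OForest K C) = 1 := by
  rw [← fof_nil, innerL, liftF_fof, innerCuts]
  rfl

theorem innerL_consPr (a : C) (c r : OForest K C) :
    innerL (consPr a c r) = cutCons a (deltaMKW c) (innerL r) := by
  induction c using OForest.induction_on with
  | add x y hx hy => simp only [map_add, LinearMap.add_apply, hx, hy]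
  | smul k x hx => simp only [map_smul, LinearMap.smul_apply, hx]
  | fof c =>
  induction r using OForest.induction_on with
  | add x y hx hy => simp only [map_add, hx, hy]
  | smul k x hx => simp only [map_smul, hx]
  | fof r =>
  rw [← fof_cons, innerL, liftF_fof, liftF_fof, innerCuts, cutMul_BplusF, deltaMKW, liftF_fof]

/-- A multiplicativity criterion for linear maps out of the shuffle algebra. -/
theorem OForest.map_mul_of_consPr {A : Type*} [CommRing A] [Algebra K A]
    (φ : OForest K C →ₗ[K] A) (h1 : φ 1 = 1)
    (h : ∀ (a b : C) (c r d s : OForest K C),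
      φ (r * consPr b d s) = φ r * φ (consPr b d s) →
      φ (consPr a c r * s) = φ (consPr a c r) * φ s →
      φ (consPr a c (r * consPr b d s)) + φ (consPr b d (consPr a c r * s)) =
        φ (consPr a c r) * φ (consPr b d s)) (x y : OForest K C) :
    φ (x * y) = φ x * φ y := by
  induction x using OForest.induction_on with
  | add x y hx hy => simp only [map_add, add_mul, hx, hy]
  | smul k x hx => simp only [map_smul, smul_mul_assoc, hx]
  | fof f =>
  induction y using OForest.induction_on with
  | add x y hx hy => simp only [map_add, mul_add, hx, hy]
  | smul k x hx => simp only [map_smul, mul_smul_comm, hx]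
  | fof g =>
  induction f generalizing g with
  | nil => rw [fof_nil, h1, one_mul, one_mul]
  | cons a c r _ ihr =>
    induction g with
    | nil => rw [fof_nil, h1, mul_one, mul_one]
    | cons b d s _ ihs =>
      have hr := ihr (.cons b d s)
      simp only [fof_cons] at hr ihs ⊢
      rw [consPr_mul_consPr, map_add, h a b _ _ _ _ hr ihs]

/-- The inner cuts as an algebra morphism. -/
noncomputable def innerHom : OForest K C →ₐ[K] OForest K C ⊗[K] OForest K C :=
  AlgHom.ofLinearMap innerL innerL_one <| OForest.map_mul_of_consPr _ innerL_one <| by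
    intro a b c r d s hr hs
    simp only [innerL_consPr] at hr hs ⊢
    rw [hr, hs, cutCons_mul_cutCons]

theorem innerL_eq_innerHom (x : OForest K C) : innerL x = innerHom x := rfl

theorem innerHom_consPr (a : C) (c r : OForest K C) :
    innerHom (consPr a c r) = cutCons a (deltaMKW c) (innerHom r) :=
  innerL_consPr a c r

/-- Deconcatenation of a forest. -/
noncomputable def deconcF : PForest C → OForest K C ⊗[K] OForest K C
  | .nil => 1 ⊗ₜ[K] 1
  | .cons a c r => 1 ⊗ₜ[K] fof (.cons a c r) +
      LinearMap.rTensor (OForest K C) (consPr a (fof c)) (deconcF r)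

/-- Linear extension of `deconcF`. -/
noncomputable def deconcL : OForest K C →ₗ[K] OForest K C ⊗[K] OForest K C :=
  liftF K deconcF

theorem deconcL_one : deconcL (1 : OForest K C) = 1 := by
  rw [← fof_nil, deconcL, liftF_fof, deconcF]
  rfl

theorem deconcL_consPr (a : C) (c r : OForest K C) :
    deconcL (consPr a c r) = 1 ⊗ₜ[K] consPr a c r +
      LinearMap.rTensor (OForest K C) (consPr a c) (deconcL r) := by
  induction c using OForest.induction_on with
  | add x y hx hy =>
    simp only [map_add, LinearMap.add_apply, TensorProduct.tmul_add, LinearMap.rTensor_add, hx, hy]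
    abel
  | smul k x hx =>
    simp only [map_smul, LinearMap.smul_apply, TensorProduct.tmul_smul, LinearMap.rTensor_smul,
      smul_add, hx]
  | fof c =>
  induction r using OForest.induction_on with
  | add x y hx hy => simp only [map_add, TensorProduct.tmul_add, hx, hy]; abel
  | smul k x hx => simp only [map_smul, TensorProduct.tmul_smul, smul_add, hx]
  | fof r =>
  rw [← fof_cons, deconcL, liftF_fof, liftF_fof, deconcF]

theorem rTensor_consPr_mul_one_tmul (a : C) (c f : OForest K C)
    (u : OForest K C ⊗[K] OForest K C) :
    LinearMap.rTensor (OForest K C) (consPr a c) u * (1 ⊗ₜ[K] f) =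
      LinearMap.rTensor (OForest K C) (consPr a c) (u * (1 ⊗ₜ[K] f)) := by
  induction u using TensorProduct.induction_on with
  | zero => simp
  | add x y hx hy => simp only [map_add, add_mul, hx, hy]
  | tmul p t => simp

theorem rTensor_consPr_mul_rTensor_consPr (a b : C) (c d : OForest K C)
    (u v : OForest K C ⊗[K] OForest K C) :
    LinearMap.rTensor (OForest K C) (consPr a c) u *
        LinearMap.rTensor (OForest K C) (consPr b d) v =
      LinearMap.rTensor (OForest K C) (consPr a c)
          (u * LinearMap.rTensor (OForest K C) (consPr b d) v) +
        LinearMap.rTensor (OForest K C) (consPr b d)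
          (LinearMap.rTensor (OForest K C) (consPr a c) u * v) := by
  induction u using TensorProduct.induction_on with
  | zero => simp
  | add x y hx hy => simp only [map_add, add_mul, hx, hy]; abel
  | tmul p t =>
  induction v using TensorProduct.induction_on with
  | zero => simp
  | add x y hx hy => simp only [map_add, mul_add, hx, hy]; abel
  | tmul q s =>
  simp [consPr_mul_consPr, TensorProduct.add_tmul]

/-- Deconcatenation as an algebra morphism. -/
noncomputable def deconcHom : OForest K C →ₐ[K] OForest K C ⊗[K] OForest K C :=
  AlgHom.ofLinearMap deconcL deconcL_one <| OForest.map_mul_of_consPr _ deconcL_one <| by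
    intro a b c r d s hr hs
    have e : (1 : OForest K C) ⊗ₜ[K] (consPr a c r * consPr b d s) =
        (1 ⊗ₜ[K] consPr a c r) * (1 ⊗ₜ[K] consPr b d s) := by simp
    rw [deconcL_consPr, hr, deconcL_consPr b d (_ * s), hs, deconcL_consPr, deconcL_consPr]
    simp only [mul_add, add_mul, map_add]
    rw [← e, consPr_mul_consPr, rTensor_consPr_mul_rTensor_consPr, rTensor_consPr_mul_one_tmul,
      mul_comm (1 ⊗ₜ[K] consPr a c r) (LinearMap.rTensor _ _ _), rTensor_consPr_mul_one_tmul,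
      mul_comm (1 ⊗ₜ[K] consPr a c r) (deconcL s), TensorProduct.tmul_add]
    abel

theorem deconcHom_consPr (a : C) (c r : OForest K C) :
    deconcHom (consPr a c r) = 1 ⊗ₜ[K] consPr a c r +
      LinearMap.rTensor (OForest K C) (consPr a c) (deconcHom r) :=
  deconcL_consPr a c r

theorem deconcHom_fof (f : PForest C) : deconcHom (fof f : OForest K C) = deconcF f :=
  liftF_fof _ _

/-- The algebra morphism `p ⊗ s ↦ (p ⊗ 1) ⧢ ι(s)`, where `ι` collects the inner cuts. -/
noncomputable def pruneHom :
    OForest K C ⊗[K] OForest K C →ₐ[K] OForest K C ⊗[K] OForest K C :=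
  Algebra.TensorProduct.productMap Algebra.TensorProduct.includeLeft innerHom

theorem pruneHom_tmul (p s : OForest K C) :
    pruneHom (p ⊗ₜ[K] s) = (p ⊗ₜ[K] 1) * innerHom s := by
  simp [pruneHom]

theorem rTensor_shPr (p : OForest K C) (u : OForest K C ⊗[K] OForest K C) :
    LinearMap.rTensor (OForest K C) (shPr p) u = (p ⊗ₜ[K] 1) * u := by
  induction u using TensorProduct.induction_on with
  | zero => simp
  | add x y hx hy => simp only [map_add, mul_add, hx, hy]
  | tmul q t => simp [shPr_eq_mul]

theorem append_nil (f : PForest C) : f.append .nil = f := by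
  induction f with
  | nil => rfl
  | cons a c r _ ih => rw [PForest.append, ih]

theorem append_assoc (f g h : PForest C) :
    (f.append g).append h = f.append (g.append h) := by
  induction f with
  | nil => rfl
  | cons a c r _ ih => simp only [PForest.append, ih]

theorem conPr_append_singleton (pre : PForest C) (a : C) (c : PForest C) :
    conPr (fof (pre.append (.cons a c .nil))) =
      conPr (fof pre) ∘ₗ consPr (K := K) a (fof c) := by
  refine OForest.hom_ext fun f => ?_
  simp [conPr, consPr, append_assoc, PForest.append]

theorem prefCuts_eq (pre f : PForest C) :
    (prefCuts pre f : OForest K C ⊗[K] OForest K C) =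
      pruneHom (LinearMap.rTensor (OForest K C) (conPr (fof pre)) (deconcF f)) := by
  have h1 : conPr (fof pre) (1 : OForest K C) = fof pre := by
    rw [← fof_nil]
    simp [conPr, append_nil]
  induction f generalizing pre with
  | nil =>
    rw [prefCuts, deconcF, LinearMap.rTensor_tmul, pruneHom_tmul, h1, map_one, mul_one, fof_nil]
  | cons a c r _ ihr =>
    rw [prefCuts, ihr, deconcF, map_add, map_add, LinearMap.rTensor_tmul, pruneHom_tmul, h1,
      rTensor_shPr, conPr_append_singleton, LinearMap.rTensor_comp_apply]
    · congr 2
      rw [fof_cons, innerHom_consPr, cutMul_BplusF, deltaMKW, liftF_fof]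
      exact congrArg _ (liftF_fof _ _).symm
    · rw [← fof_nil]
      simp [conPr, append_nil]

/-- The coproduct as an algebra morphism for the shuffle product. -/
noncomputable def deltaHom : OForest K C →ₐ[K] OForest K C ⊗[K] OForest K C :=
  pruneHom.comp deconcHom

theorem deltaMKW_eq (x : OForest K C) : deltaMKW x = deltaHom x := by
  have hc : conPr (fof .nil) = (LinearMap.id : OForest K C →ₗ[K] OForest K C) :=
    OForest.hom_ext fun f => by simp [conPr, PForest.append]
  suffices h : deltaMKW = (deltaHom (K := K) (C := C)).toLinearMap from LinearMap.congr_fun h x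
  refine OForest.hom_ext fun f => ?_
  rw [deltaMKW, liftF_fof, prefCuts_eq, hc, LinearMap.rTensor_id, LinearMap.id_apply,
    AlgHom.toLinearMap_apply, deltaHom, AlgHom.comp_apply, deconcHom_fof]

/-- The unnormalised grafting operator `ω₁ ⊗ ω₂ ↦ Σ_v ω₁ ⊤_v ω₂`. -/
noncomputable def graftL : OForest K C →ₗ[K] OForest K C →ₗ[K] OForest K C :=
  liftF2 K graftShuffleF

theorem graftL_one_right (x : OForest K C) : graftL x 1 = 0 := by
  suffices h : graftL.flip (1 : OForest K C) = 0 from LinearMap.congr_fun h x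
  refine OForest.hom_ext fun f => ?_
  rw [← fof_nil, LinearMap.flip_apply, graftL, liftF2_fof_fof, graftShuffleF,
    LinearMap.zero_apply]

theorem graftL_consPr (x : OForest K C) (a : C) (c r : OForest K C) :
    graftL x (consPr a c r) =
      consPr a (x * c) r + consPr a (graftL x c) r + consPr a c (graftL x r) := by
  induction x using OForest.induction_on with
  | add x y hx hy => simp only [map_add, LinearMap.add_apply, add_mul, hx, hy]; abel
  | smul k x hx =>
    simp only [map_smul, LinearMap.smul_apply, smul_mul_assoc, hx, smul_add]
  | fof w =>
  induction c using OForest.induction_on with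
  | add x y hx hy => simp only [map_add, LinearMap.add_apply, mul_add, hx, hy]; abel
  | smul k x hx =>
    simp only [map_smul, LinearMap.smul_apply, mul_smul_comm, hx, smul_add]
  | fof c =>
  induction r using OForest.induction_on with
  | add x y hx hy => simp only [map_add, hx, hy]; abel
  | smul k x hx => simp only [map_smul, hx, smul_add]
  | fof r =>
  have h1 : (liftF K fun f => fof (PForest.cons a f r)) = (consPr (K := K) a).flip (fof r) :=
    OForest.hom_ext fun f => by simp [consPr]
  have h2 : (liftF K fun f => fof (PForest.cons a c f)) = consPr (K := K) a (fof c) :=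
    OForest.hom_ext fun f => by simp [consPr]
  have h3 : ((shuffles w c).map fun s => (fof (PForest.cons a s r) : OForest K C)).sum =
      consPr a (fof w * fof c) (fof r) := by
    rw [← shPr_eq_mul, shPr, liftF2_fof_fof, ← LinearMap.flip_apply, map_sum_fof]
    simp only [LinearMap.flip_apply, ← fof_cons]
  rw [← fof_cons, graftL, liftF2_fof_fof, liftF2_fof_fof, liftF2_fof_fof, graftShuffleF, h1, h2,
    h3, LinearMap.flip_apply]

/-- Grafting a fixed element is a derivation of the shuffle product. -/
theorem graftL_mul (x y z : OForest K C) :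
    graftL x (y * z) = graftL x y * z + y * graftL x z := by
  induction y using OForest.induction_on with
  | add y y' hy hy' => simp only [map_add, add_mul, hy, hy']; abel
  | smul k y hy => simp only [map_smul, smul_mul_assoc, hy, smul_add]
  | fof f =>
  induction z using OForest.induction_on with
  | add z z' hz hz' => simp only [map_add, mul_add, hz, hz']; abel
  | smul k z hz => simp only [map_smul, mul_smul_comm, hz, smul_add]
  | fof g =>
  induction f generalizing g with
  | nil => simp [fof_nil, graftL_one_right]
  | cons a c r _ ihr =>
    induction g with
    | nil => simp [fof_nil, graftL_one_right]
    | cons b d s _ ihs =>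
      have hr := ihr (.cons b d s)
      simp only [fof_cons] at hr ihs ⊢
      rw [consPr_mul_consPr, map_add, graftL_consPr, graftL_consPr, hr, ihs]
      simp only [graftL_consPr, add_mul, mul_add, map_add, consPr_mul_consPr]
      abel

/-- The bilinear map `(p ⊗ t, p' ⊗ t') ↦ (p ⧢ p') ⊗ (Σ_v t ⊤_v t')`. -/
noncomputable def graftT :
    OForest K C ⊗[K] OForest K C →ₗ[K] OForest K C ⊗[K] OForest K C →ₗ[K]
      OForest K C ⊗[K] OForest K C :=
  TensorProduct.map₂ (LinearMap.mul K (OForest K C)) graftL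

theorem graftT_tmul (p t p' t' : OForest K C) :
    graftT (p ⊗ₜ[K] t) (p' ⊗ₜ[K] t') = (p * p') ⊗ₜ[K] graftL t t' := by
  simp [graftT]

theorem graftT_tmul_one (u : OForest K C ⊗[K] OForest K C) (y : OForest K C) :
    graftT u (y ⊗ₜ[K] 1) = 0 := by
  induction u using TensorProduct.induction_on with
  | zero => simp
  | add x y hx hy => simp only [map_add, LinearMap.add_apply, hx, hy, add_zero]
  | tmul p t => simp [graftT_tmul, graftL_one_right]

theorem graftT_one_tmul (u : OForest K C ⊗[K] OForest K C) (y : OForest K C) :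
    graftT u (1 ⊗ₜ[K] y) = LinearMap.lTensor (OForest K C) (graftL.flip y) u := by
  induction u using TensorProduct.induction_on with
  | zero => simp
  | add x y hx hy => simp only [map_add, LinearMap.add_apply, hx, hy]
  | tmul p t => simp [graftT_tmul]

theorem graftT_tmul_one_mul (u : OForest K C ⊗[K] OForest K C) (p : OForest K C)
    (v : OForest K C ⊗[K] OForest K C) :
    graftT u ((p ⊗ₜ[K] 1) * v) = (p ⊗ₜ[K] 1) * graftT u v := by
  induction u using TensorProduct.induction_on with
  | zero => simp
  | add x y hx hy => simp only [map_add, LinearMap.add_apply, mul_add, hx, hy]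
  | tmul q s =>
  induction v using TensorProduct.induction_on with
  | zero => simp
  | add x y hx hy => simp only [map_add, mul_add, hx, hy]
  | tmul q' s' => simp [graftT_tmul, mul_left_comm]

theorem graftT_cutCons (w : OForest K C ⊗[K] OForest K C) (a : C)
    (u v : OForest K C ⊗[K] OForest K C) :
    graftT w (cutCons a u v) =
      cutCons a (w * u) v + cutCons a (graftT w u) v + cutCons a u (graftT w v) := by
  induction w using TensorProduct.induction_on with
  | zero => simp
  | add x y hx hy => simp only [map_add, LinearMap.add_apply, add_mul, hx, hy]; abel
  | tmul p t =>
  induction u using TensorProduct.induction_on with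
  | zero => simp
  | add x y hx hy => simp only [map_add, LinearMap.add_apply, mul_add, hx, hy]; abel
  | tmul q s =>
  induction v using TensorProduct.induction_on with
  | zero => simp
  | add x y hx hy => simp only [map_add, hx, hy]; abel
  | tmul q' s' =>
  simp only [cutCons_tmul, graftT_tmul, graftL_consPr, TensorProduct.tmul_add,
    Algebra.TensorProduct.tmul_mul_tmul, mul_assoc, mul_left_comm]

theorem rTensor_graftL_cutCons (x : OForest K C) (a : C)
    (u v : OForest K C ⊗[K] OForest K C) :
    LinearMap.rTensor (OForest K C) (graftL x) (cutCons a u v) =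
      cutCons a (LinearMap.rTensor (OForest K C) (graftL x) u) v +
        cutCons a u (LinearMap.rTensor (OForest K C) (graftL x) v) := by
  induction u using TensorProduct.induction_on with
  | zero => simp
  | add x y hx hy => simp only [map_add, LinearMap.add_apply, hx, hy]; abel
  | tmul q s =>
  induction v using TensorProduct.induction_on with
  | zero => simp
  | add x y hx hy => simp only [map_add, hx, hy]; abel
  | tmul q' s' =>
  simp only [cutCons_tmul, LinearMap.rTensor_tmul, graftL_mul, TensorProduct.add_tmul]

theorem rTensor_graftL_tmul_one_mul (x p : OForest K C) (v : OForest K C ⊗[K] OForest K C) :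
    LinearMap.rTensor (OForest K C) (graftL x) ((p ⊗ₜ[K] 1) * v) =
      (graftL x p ⊗ₜ[K] 1) * v +
        (p ⊗ₜ[K] 1) * LinearMap.rTensor (OForest K C) (graftL x) v := by
  induction v using TensorProduct.induction_on with
  | zero => simp
  | add x y hx hy => simp only [map_add, mul_add, hx, hy]; abel
  | tmul q s => simp [graftL_mul, TensorProduct.add_tmul]

theorem deconcHom_graftL (x y : OForest K C) :
    deconcHom (graftL x y) =
      LinearMap.rTensor (OForest K C) (graftL x) (deconcHom y) +
        LinearMap.lTensor (OForest K C) (graftL x) (deconcHom y) := by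
  have rl : ∀ (a : C) (c : OForest K C) (u : OForest K C ⊗[K] OForest K C),
      LinearMap.rTensor (OForest K C) (graftL x)
          (LinearMap.rTensor (OForest K C) (consPr a c) u) =
        LinearMap.rTensor (OForest K C) (consPr a (x * c)) u +
        LinearMap.rTensor (OForest K C) (consPr a (graftL x c)) u +
        LinearMap.rTensor (OForest K C) (consPr a c)
          (LinearMap.rTensor (OForest K C) (graftL x) u) := fun a c u => by
    induction u using TensorProduct.induction_on with
    | zero => simp
    | add u v hu hv => simp only [map_add, hu, hv]; abel
    | tmul p t => simp [graftL_consPr, TensorProduct.add_tmul]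
  have ll : ∀ (a : C) (c : OForest K C) (u : OForest K C ⊗[K] OForest K C),
      LinearMap.lTensor (OForest K C) (graftL x)
          (LinearMap.rTensor (OForest K C) (consPr a c) u) =
        LinearMap.rTensor (OForest K C) (consPr a c)
          (LinearMap.lTensor (OForest K C) (graftL x) u) := fun a c u => by
    induction u using TensorProduct.induction_on with
    | zero => simp
    | add u v hu hv => simp only [map_add, hu, hv]
    | tmul p t => simp
  induction y using OForest.induction_on with
  | add y y' hy hy' => simp only [map_add, hy, hy']; abel
  | smul k y hy => simp only [map_smul, hy, smul_add]
  | fof f =>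
  induction f with
  | nil =>
    rw [fof_nil, graftL_one_right, map_one, Algebra.TensorProduct.one_def]
    simp [graftL_one_right]
  | cons a c r _ ihr =>
    rw [fof_cons, graftL_consPr]
    simp only [map_add, deconcHom_consPr, ihr, rl, ll, LinearMap.rTensor_tmul,
      LinearMap.lTensor_tmul, graftL_one_right, graftL_consPr, TensorProduct.tmul_add,
      TensorProduct.zero_tmul]
    abel

/-- The operator `(x ⊤ ·) ⊗ id + Δ(x) ⊤ ·` through which a coproduct passes a grafting of `x`. -/
noncomputable def graftCop (x : OForest K C) :
    OForest K C ⊗[K] OForest K C →ₗ[K] OForest K C ⊗[K] OForest K C :=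
  LinearMap.rTensor (OForest K C) (graftL x) + graftT (deltaHom x)

theorem graftCop_one (x : OForest K C) : graftCop x 1 = 0 := by
  rw [graftCop, LinearMap.add_apply, Algebra.TensorProduct.one_def, graftT_tmul_one]
  simp [graftL_one_right]

theorem pruneHom_graftL (x : OForest K C) (u : OForest K C ⊗[K] OForest K C)
    (h : LinearMap.lTensor (OForest K C) (innerL ∘ₗ graftL x) u =
      LinearMap.lTensor (OForest K C) (graftCop x ∘ₗ innerL) u) :
    pruneHom (LinearMap.rTensor (OForest K C) (graftL x) u +
        LinearMap.lTensor (OForest K C) (graftL x) u) =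
      graftCop x (pruneHom u) := by
  let m : OForest K C ⊗[K] (OForest K C ⊗[K] OForest K C) →ₗ[K] OForest K C ⊗[K] OForest K C :=
    (Algebra.TensorProduct.productMap Algebra.TensorProduct.includeLeft
      (AlgHom.id K (OForest K C ⊗[K] OForest K C))).toLinearMap
  have hm : ∀ p v, m (p ⊗ₜ[K] v) = (p ⊗ₜ[K] 1) * v := fun p v => by simp [m]
  have e : pruneHom (LinearMap.lTensor (OForest K C) (graftL x) u) =
      m (LinearMap.lTensor (OForest K C) (innerL ∘ₗ graftL x) u) := by
    clear h
    induction u using TensorProduct.induction_on with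
    | zero => simp
    | add u v hu hv => simp only [map_add, hu, hv]
    | tmul p t => simp [hm, pruneHom_tmul, innerL_eq_innerHom]
  rw [map_add, e, h]
  clear h e
  induction u using TensorProduct.induction_on with
  | zero => simp
  | add u v hu hv => simp only [map_add, ← hu, ← hv]; abel
  | tmul p t =>
    simp only [LinearMap.rTensor_tmul, LinearMap.lTensor_tmul, LinearMap.comp_apply,
      innerL_eq_innerHom, hm, pruneHom_tmul, graftCop, LinearMap.add_apply,
      rTensor_graftL_tmul_one_mul, graftT_tmul_one_mul, mul_add, add_assoc]

theorem innerHom_graftL_and_lTensor (x : OForest K C) (f : PForest C) :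
    innerHom (graftL x (fof f)) = graftCop x (innerHom (fof f)) ∧
      LinearMap.lTensor (OForest K C) (innerL ∘ₗ graftL x) (deconcHom (fof f)) =
        LinearMap.lTensor (OForest K C) (graftCop x ∘ₗ innerL)
          (deconcHom (fof f)) := by
  induction f with
  | nil =>
    rw [fof_nil, map_one innerHom, graftL_one_right, graftCop_one, map_zero, map_one deconcHom,
      Algebra.TensorProduct.one_def]
    simp [graftL_one_right, innerL_one, graftCop_one]
  | cons a c r ihc ihr =>
    have hc : deltaHom (graftL x (fof c)) = graftCop x (deltaHom (fof c)) := by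
      simp only [deltaHom, AlgHom.comp_apply]
      rw [deconcHom_graftL, pruneHom_graftL x _ ihc.2]
    have hi : innerHom (graftL x (consPr a (fof c) (fof r))) =
        graftCop x (innerHom (consPr a (fof c) (fof r))) := by
      rw [graftL_consPr]
      simp only [map_add, innerHom_consPr, deltaMKW_eq, hc, ihr.1, map_mul]
      simp only [graftCop, LinearMap.add_apply, map_add, rTensor_graftL_cutCons,
        graftT_cutCons]
      abel
    have lr : ∀ (ψ : OForest K C →ₗ[K] OForest K C ⊗[K] OForest K C)
        (u : OForest K C ⊗[K] OForest K C),
        LinearMap.lTensor (OForest K C) ψ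
            (LinearMap.rTensor (OForest K C) (consPr a (fof c)) u) =
          LinearMap.rTensor (OForest K C ⊗[K] OForest K C) (consPr a (fof c))
            (LinearMap.lTensor (OForest K C) ψ u) := fun ψ u => by
      rw [← LinearMap.comp_apply, ← LinearMap.comp_apply, LinearMap.lTensor_comp_rTensor,
        LinearMap.rTensor_comp_lTensor]
    rw [fof_cons]
    refine ⟨hi, ?_⟩
    rw [deconcHom_consPr, map_add, map_add, lr, lr, ihr.2, LinearMap.lTensor_tmul,
      LinearMap.lTensor_tmul, LinearMap.comp_apply, LinearMap.comp_apply,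
      innerL_eq_innerHom, innerL_eq_innerHom, hi]

/-- The coproduct of a grafting: either the vertex grafted upon is pruned, or it remains in
the trunk. -/
theorem deltaHom_graftL (x y : OForest K C) :
    deltaHom (graftL x y) =
      LinearMap.rTensor (OForest K C) (graftL x) (deltaHom y) +
        graftT (deltaHom x) (deltaHom y) := by
  change _ = graftCop x (deltaHom y)
  induction y using OForest.induction_on with
  | add y y' hy hy' => simp only [map_add, hy, hy']
  | smul k y hy => simp only [map_smul, hy]
  | fof f =>
    simp only [deltaHom, AlgHom.comp_apply]
    rw [deconcHom_graftL, pruneHom_graftL x _ (innerHom_graftL_and_lTensor x f).2]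

theorem redMKW_eq (x : OForest K C) :
    redMKW x = deltaHom x - x ⊗ₜ[K] 1 - 1 ⊗ₜ[K] x := by
  rw [← deltaMKW_eq]
  rfl

theorem deltaHom_of_primitive {y : OForest K C} (hy : redMKW y = 0) :
    deltaHom y = y ⊗ₜ[K] 1 + 1 ⊗ₜ[K] y := by
  rw [redMKW_eq, sub_sub, sub_eq_zero] at hy
  exact hy

theorem deltaHom_graftL_of_primitive (x : OForest K C) {y : OForest K C}
    (hy : redMKW y = 0) :
    deltaHom (graftL x y) =
      graftL x y ⊗ₜ[K] 1 + LinearMap.lTensor (OForest K C) (graftL.flip y) (deltaHom x) := by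
  rw [deltaHom_graftL, deltaHom_of_primitive hy, map_add, map_add, graftT_tmul_one,
    graftT_one_tmul, LinearMap.rTensor_tmul, LinearMap.rTensor_tmul, graftL_one_right,
    TensorProduct.zero_tmul, add_zero, zero_add]

theorem graftL_one_fof (f : PForest C) :
    graftL 1 (fof f) = (f.size : K) • (fof f : OForest K C) := by
  induction f with
  | nil => simp [fof_nil, graftL_one_right, PForest.size]
  | cons a c r ihc ihr =>
    rw [fof_cons, graftL_consPr, ihc, ihr, one_mul]
    simp only [map_smul, LinearMap.smul_apply, PForest.size, Nat.cast_add, Nat.cast_one, add_smul,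
      one_smul]

theorem redMKW_graftL_one {y : OForest K C} (hy : redMKW y = 0) :
    redMKW (graftL 1 y) = 0 := by
  rw [redMKW_eq, deltaHom_graftL_of_primitive 1 hy, map_one deltaHom, Algebra.TensorProduct.one_def,
    LinearMap.lTensor_tmul, LinearMap.flip_apply, add_sub_cancel_left, sub_self]

theorem redMKW_aeval_graftL_one (q : Polynomial K) {y : OForest K C} (hy : redMKW y = 0) :
    redMKW (Polynomial.aeval (graftL (1 : OForest K C)) q y) = 0 := by
  induction q using Polynomial.induction_on' with
  | add p q hp hq => rw [map_add, LinearMap.add_apply, map_add, hp, hq, add_zero]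
  | monomial n a =>
    have h : ∀ n : ℕ, redMKW ((graftL (1 : OForest K C) ^ n) y) = 0 := fun n => by
      induction n with
      | zero => simpa using hy
      | succ n ih => rw [pow_succ', Module.End.mul_apply, redMKW_graftL_one ih]
    rw [Polynomial.aeval_monomial, Module.End.mul_apply, Module.algebraMap_end_apply, map_smul,
      h, smul_zero]

/-- Division of each forest by its number of vertices. -/
noncomputable def invSize : OForest K C →ₗ[K] OForest K C :=
  liftF K fun f => (f.size : K)⁻¹ • fof f

theorem topMKW_eq (x y : OForest K C) : topMKW x y = graftL x (invSize y) := by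
  suffices h : topMKW (K := K) (C := C) = graftL.compl₂ invSize from LinearMap.congr_fun₂ h x y
  refine OForest.hom_ext fun f => OForest.hom_ext fun g => ?_
  simp [topMKW, graftL, invSize]

theorem exists_invSize_eq_aeval [CharZero K] (y : OForest K C) :
    ∃ q : Polynomial K, invSize y = Polynomial.aeval (graftL (1 : OForest K C)) q y := by
  obtain ⟨n, hn⟩ : ∃ n : ℕ, ∀ q : Polynomial K, (∀ k ≤ n, q.eval (k : K) = (k : K)⁻¹) →
      invSize y = Polynomial.aeval (graftL (1 : OForest K C)) q y := by
    induction y using OForest.induction_on with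
    | add x y hx hy =>
      obtain ⟨n, hn⟩ := hx
      obtain ⟨m, hm⟩ := hy
      refine ⟨max n m, fun q hq => ?_⟩
      rw [map_add, map_add, hn q fun k hk => hq k (le_max_of_le_left hk),
        hm q fun k hk => hq k (le_max_of_le_right hk)]
    | smul k x hx =>
      obtain ⟨n, hn⟩ := hx
      exact ⟨n, fun q hq => by rw [map_smul, map_smul, hn q hq]⟩
    | fof f =>
      refine ⟨f.size, fun q hq => ?_⟩
      have h : ∀ n : ℕ, (graftL (1 : OForest K C) ^ n) (fof f) = (f.size : K) ^ n • fof f :=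
        fun n => by
          induction n with
          | zero => simp
          | succ n ih =>
            rw [pow_succ', Module.End.mul_apply, ih, map_smul, graftL_one_fof, smul_smul, pow_succ]
      rw [invSize, liftF_fof, ← hq _ le_rfl, Polynomial.aeval_eq_sum_range,
        Polynomial.eval_eq_sum_range, LinearMap.sum_apply, Finset.sum_smul]
      exact Finset.sum_congr rfl fun i _ => by rw [LinearMap.smul_apply, h, smul_smul]
  refine ⟨Lagrange.interpolate (Finset.range (n + 1)) (fun k => (k : K)) fun k => (k : K)⁻¹,
    hn _ fun k hk => ?_⟩
  exact Lagrange.eval_interpolate_at_node (v := fun k : ℕ => (k : K)) _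
    Nat.cast_injective.injOn (Finset.mem_range.2 (Nat.lt_succ_of_le hk))

theorem redMKW_invSize [CharZero K] {y : OForest K C} (hy : redMKW y = 0) :
    redMKW (invSize y) = 0 := by
  obtain ⟨q, hq⟩ := exists_invSize_eq_aeval y
  rw [hq, redMKW_aeval_graftL_one q hy]

/-- The counit: the coefficient of the empty forest. -/
noncomputable def counitL : OForest K C →ₗ[K] K :=
  liftF K fun
    | .nil => 1
    | .cons _ _ _ => 0

theorem counitL_one : counitL (1 : OForest K C) = 1 := by
  rw [← fof_nil, counitL, liftF_fof]

theorem counitL_consPr (a : C) (c r : OForest K C) : counitL (consPr a c r) = 0 := by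
  suffices h : (consPr a).compr₂ counitL = (0 : OForest K C →ₗ[K] OForest K C →ₗ[K] K) from
    LinearMap.congr_fun₂ h c r
  refine OForest.hom_ext fun f => OForest.hom_ext fun g => ?_
  rw [LinearMap.compr₂_apply, ← fof_cons, counitL, liftF_fof]
  rfl

/-- Evaluation of the counit on the second tensor factor. -/
noncomputable def counitR : OForest K C ⊗[K] OForest K C →ₗ[K] OForest K C :=
  (TensorProduct.rid K (OForest K C)).toLinearMap ∘ₗ LinearMap.lTensor (OForest K C) counitL

theorem counitR_tmul (p s : OForest K C) : counitR (p ⊗ₜ[K] s) = counitL s • p := by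
  simp [counitR]

theorem counitR_cutCons (a : C) (u v : OForest K C ⊗[K] OForest K C) :
    counitR (cutCons a u v) = 0 := by
  induction u using TensorProduct.induction_on with
  | zero => simp
  | add x y hx hy => simp only [map_add, LinearMap.add_apply, hx, hy, add_zero]
  | tmul p t =>
  induction v using TensorProduct.induction_on with
  | zero => simp
  | add x y hx hy => simp only [map_add, hx, hy, add_zero]
  | tmul q s => rw [cutCons_tmul, counitR_tmul, counitL_consPr, zero_smul]

theorem counitR_innerHom (x : OForest K C) : counitR (innerHom x) = counitL x • 1 := by
  induction x using OForest.induction_on with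
  | add x y hx hy => simp only [map_add, hx, hy, add_smul]
  | smul k x hx => simp only [map_smul, hx, smul_assoc]
  | fof f =>
  cases f with
  | nil => rw [fof_nil, map_one, Algebra.TensorProduct.one_def, counitR_tmul]
  | cons a c r => rw [fof_cons, innerHom_consPr, counitR_cutCons, counitL_consPr, zero_smul]

theorem counitR_tmul_one_mul (p : OForest K C) (u : OForest K C ⊗[K] OForest K C) :
    counitR ((p ⊗ₜ[K] 1) * u) = p * counitR u := by
  induction u using TensorProduct.induction_on with
  | zero => simp
  | add x y hx hy => simp only [map_add, mul_add, hx, hy]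
  | tmul q s => simp [counitR_tmul]

theorem counitR_pruneHom (u : OForest K C ⊗[K] OForest K C) :
    counitR (pruneHom u) = counitR u := by
  induction u using TensorProduct.induction_on with
  | zero => simp
  | add x y hx hy => simp only [map_add, hx, hy]
  | tmul p s =>
    rw [pruneHom_tmul, counitR_tmul_one_mul, counitR_innerHom, counitR_tmul, mul_smul_comm, mul_one]

theorem counitR_rTensor (φ : OForest K C →ₗ[K] OForest K C)
    (u : OForest K C ⊗[K] OForest K C) :
    counitR (LinearMap.rTensor (OForest K C) φ u) = φ (counitR u) := by
  induction u using TensorProduct.induction_on with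
  | zero => simp
  | add x y hx hy => simp only [map_add, hx, hy]
  | tmul p s => simp [counitR_tmul]

theorem counitR_deltaHom (x : OForest K C) : counitR (deltaHom x) = x := by
  rw [deltaHom, AlgHom.comp_apply, counitR_pruneHom]
  induction x using OForest.induction_on with
  | add x y hx hy => simp only [map_add, hx, hy]
  | smul k x hx => simp only [map_smul, hx]
  | fof f =>
  induction f with
  | nil => rw [fof_nil, map_one, Algebra.TensorProduct.one_def, counitR_tmul, counitL_one, one_smul]
  | cons a c r _ ihr =>
    rw [fof_cons, deconcHom_consPr, map_add, counitR_tmul, counitL_consPr, zero_smul, zero_add,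
      counitR_rTensor, ihr]

theorem counitL_of_primitive {y : OForest K C} (hy : redMKW y = 0) : counitL y = 0 := by
  have h := congrArg counitR (deltaHom_of_primitive hy)
  rw [counitR_deltaHom, map_add, counitR_tmul, counitR_tmul, counitL_one, one_smul,
    left_eq_add] at h
  have h' := congrArg counitL h
  rwa [map_smul, counitL_one, map_zero, smul_eq_mul, mul_one] at h'

theorem graftL_one_invSize [CharZero K] (y : OForest K C) :
    graftL 1 (invSize y) = y - counitL y • 1 := by
  induction y using OForest.induction_on with
  | add x y hx hy => simp only [map_add, hx, hy, add_smul]; abel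
  | smul k x hx => simp only [map_smul, hx, smul_sub, smul_assoc]
  | fof f =>
  cases f with
  | nil =>
    rw [fof_nil, counitL_one, one_smul, sub_self, ← fof_nil, invSize, liftF_fof, map_smul,
      fof_nil, graftL_one_right, smul_zero]
  | cons a c r =>
    have h : ((PForest.cons a c r).size : K) ≠ 0 := by
      rw [PForest.size, Nat.cast_ne_zero]
      omega
    rw [invSize, liftF_fof, map_smul, graftL_one_fof, inv_smul_smul₀ h, fof_cons, counitL_consPr,
      zero_smul, sub_zero]

theorem redMKW_topMKW [CharZero K] (x : OForest K C) {y : OForest K C} (hy : redMKW y = 0) :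
    redMKW (topMKW x y) =
      x ⊗ₜ[K] y + LinearMap.lTensor (OForest K C) (topMKW.flip y) (redMKW x) := by
  have hf : topMKW.flip y = graftL.flip (invSize y) := LinearMap.ext fun z => topMKW_eq z y
  have h1 : graftL 1 (invSize y) = y := by
    rw [graftL_one_invSize, counitL_of_primitive hy, zero_smul, sub_zero]
  rw [hf, topMKW_eq, redMKW_eq, redMKW_eq x, deltaHom_graftL_of_primitive x (redMKW_invSize hy),
    map_sub, map_sub, LinearMap.lTensor_tmul, LinearMap.lTensor_tmul, LinearMap.flip_apply,
    LinearMap.flip_apply, h1]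
  abel

end ShuffleAlgebra

theorem topMKW_is_natural_growth {K : Type*} [Field K] [CharZero K] {C : Type*} :
    ∀ x y : OForest K C, redMKW y = 0 →
      redMKW (topMKW x y) =
        x ⊗ₜ[K] y +
          (TensorProduct.map LinearMap.id (topMKW.flip y)) (redMKW x) := by
  exact fun x y hy => redMKW_topMKW x hy
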